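/- Let X be a real Hilbert space, T > 0, I = (0,T), 0 < m ≤ M, and let b : X × X → ℝ be a symmetric bilinear form with m‖v‖² ≤ b(v,v) and |b(w,v)| ≤ M‖w‖‖v‖ for all v, w ∈ X. Let w ∈ W^{1,2}(I;X) with derivative ẇ and F ∈ W^{1,2}(I;X*) with derivative Ḟ, and assume b(w(s), ẇ(s)) ≤ ⟨F(s), ẇ(s)⟩ for a.e. s ∈ I. Then there exists a constant C > 0 depending only on m, M and T such that sup_{t∈[0,T]} ‖w(t)‖ ≤ C (‖w(0)‖ + sup_{t∈[0,T]} ‖F(t)‖_{X*} + (∫₀ᵀ ‖Ḟ(s)‖_{X*}² ds)^{1/2}). -/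

import Mathlib

open MeasureTheory Set Filter
open scoped ENNReal NNReal Topology

noncomputable section

/-- `u : [0,T] → E` belongs to `W^{1,p}((0,T); E)` with derivative `du`:
`du` is strongly measurable on `(0,T)` with finite `L^p` norm, and
`u t = u 0 + ∫₀ᵗ du` (Bochner integral) for every `t ∈ [0,T]`. -/
def MemW1p {E : Type*} [NormedAddCommGroup E] [NormedSpace ℝ E]
    (T : ℝ) (p : ℝ≥0∞) (u du : ℝ → E) : Prop :=
  AEStronglyMeasurable du (volume.restrict (Ioo 0 T)) ∧
  eLpNorm du p (volume.restrict (Ioo 0 T)) < ⊤ ∧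
  ∀ t ∈ Icc (0 : ℝ) T, u t = u 0 + ∫ s in (0 : ℝ)..t, du s

/-- An admissible bilinear form on a Hilbert space `X`: symmetric, bilinear,
coercive with constant `m` and bounded with constant `M`. -/
def AdmissibleForm {X : Type*} [NormedAddCommGroup X] [InnerProductSpace ℝ X]
    (m M : ℝ) (a : X → X → ℝ) : Prop :=
  (∀ v w, a v w = a w v) ∧
  (∀ v w z, a (v + w) z = a v z + a w z) ∧
  (∀ (c : ℝ) (v w : X), a (c • v) w = c * a v w) ∧
  (∀ v, m * ‖v‖ ^ 2 ≤ a v v) ∧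
  (∀ v w, |a v w| ≤ M * ‖v‖ * ‖w‖)

/-- An admissible functional on `X`: nonnegative, convex, positively homogeneous
and Lipschitz continuous. -/
def AdmissibleJ {X : Type*} [NormedAddCommGroup X] [InnerProductSpace ℝ X]
    (j : X → ℝ) : Prop :=
  (∀ v, 0 ≤ j v) ∧ ConvexOn ℝ univ j ∧
  (∀ (c : ℝ) (v : X), j (c • v) = |c| * j v) ∧
  (∃ L : ℝ≥0, LipschitzWith L j)

/-- `u` (with derivative `du`) is a solution of the quasistatic variational
inequality with data `(a, j, f, ustar)`. -/
def IsQVISol {X : Type*} [NormedAddCommGroup X] [InnerProductSpace ℝ X]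
    (T : ℝ) (p : ℝ≥0∞) (a : X → X → ℝ) (j : X → ℝ)
    (f : ℝ → (X →L[ℝ] ℝ)) (ustar : X) (u du : ℝ → X) : Prop :=
  MemW1p T p u du ∧ u 0 = ustar ∧
  ∀ᵐ t ∂(volume.restrict (Ioo 0 T)), ∀ v : X,
    a (u t) (v - du t) + j v - j (du t) ≥ (f t) (v - du t)

universe u

lemma AbsolutelyContinuousOnInterval.of_dist_le {X Y : Type*} [PseudoMetricSpace X]
    [PseudoMetricSpace Y] {f : ℝ → X} {g : ℝ → Y} {a b : ℝ}
    (hg : AbsolutelyContinuousOnInterval g a b)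
    (h : ∀ x ∈ uIcc a b, ∀ y ∈ uIcc a b, dist (f x) (f y) ≤ dist (g x) (g y)) :
    AbsolutelyContinuousOnInterval f a b := by
  rw [absolutelyContinuousOnInterval_iff] at hg ⊢
  intro ε hε
  obtain ⟨δ, hδ, H⟩ := hg ε hε
  refine ⟨δ, hδ, fun E hE hEδ ↦ (Finset.sum_le_sum fun i hi ↦ ?_).trans_lt (H E hE hEδ)⟩
  exact h _ (hE.1 i hi).1 _ (hE.1 i hi).2

lemma AbsolutelyContinuousOnInterval.bilinear {E F G : Type*} [NormedAddCommGroup E]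
    [NormedSpace ℝ E] [NormedAddCommGroup F] [NormedSpace ℝ F] [NormedAddCommGroup G]
    [NormedSpace ℝ G] (B : E →L[ℝ] F →L[ℝ] G) {u : ℝ → E} {v : ℝ → F} {a b : ℝ}
    (hu : AbsolutelyContinuousOnInterval u a b) (hv : AbsolutelyContinuousOnInterval v a b) :
    AbsolutelyContinuousOnInterval (fun x ↦ B (u x) (v x)) a b := by
  obtain ⟨C, hC⟩ := hu.exists_bound
  obtain ⟨D, hD⟩ := hv.exists_bound
  unfold AbsolutelyContinuousOnInterval at hu hv
  refine squeeze_zero' (.of_forall fun _ ↦ Finset.sum_nonneg fun i hi ↦ dist_nonneg) ?_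
    (by simpa using (hv.const_mul (‖B‖ * C)).add (hu.const_mul (‖B‖ * D)))
  rw [eventually_inf_principal]
  filter_upwards with (n, I) hnI
  simp only [Finset.mul_sum, ← Finset.sum_add_distrib]
  refine Finset.sum_le_sum fun i hi ↦ ?_
  obtain ⟨h1, h2⟩ := hnI.1 i hi
  set x := (I i).1
  set y := (I i).2
  have key : B (u x) (v x) - B (u y) (v y) = B (u x) (v x - v y) + B (u x - u y) (v y) := by
    simp
  rw [dist_eq_norm, dist_eq_norm, dist_eq_norm, key]
  refine (norm_add_le _ _).trans (add_le_add ?_ ?_)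
  · refine (B.le_opNorm₂ _ _).trans ?_
    gcongr
    exact hC x h1
  · refine (B.le_opNorm₂ _ _).trans ?_
    rw [mul_right_comm]
    gcongr
    exact hD y h2

namespace MemW1p

variable {E : Type*} [NormedAddCommGroup E] [NormedSpace ℝ E] {T : ℝ} {p : ℝ≥0∞} {u du : ℝ → E}

lemma memLp (h : MemW1p T p u du) : MemLp du p (volume.restrict (Ioo 0 T)) :=
  ⟨h.1, h.2.1⟩

lemma integrableOn (h : MemW1p T p u du) (hp : 1 ≤ p) : IntegrableOn du (Ioo 0 T) :=
  h.memLp.integrable hp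

lemma intervalIntegrable (h : MemW1p T p u du) (hp : 1 ≤ p) (hT : 0 ≤ T) :
    IntervalIntegrable du volume 0 T :=
  (intervalIntegrable_iff_integrableOn_Ioo_of_le hT).2 (h.integrableOn hp)

lemma absolutelyContinuousOnInterval (h : MemW1p T p u du) (hp : 1 ≤ p) (hT : 0 ≤ T) :
    AbsolutelyContinuousOnInterval u 0 T := by
  have hi := h.intervalIntegrable hp hT
  refine (hi.norm.absolutelyContinuousOnInterval_intervalIntegral left_mem_uIcc).of_dist_le
    fun x hx y hy ↦ ?_
  have h0 : ∀ z ∈ uIcc 0 T, IntervalIntegrable du volume 0 z := fun z hz ↦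
    hi.mono_set (uIcc_subset_uIcc left_mem_uIcc hz)
  have hu : ∀ z ∈ uIcc 0 T, u z = u 0 + ∫ s in (0 : ℝ)..z, du s := fun z hz ↦
    h.2.2 z (by rwa [uIcc_of_le hT] at hz)
  rw [dist_eq_norm, dist_eq_norm, hu x hx, hu y hy, add_sub_add_left_eq_sub,
    intervalIntegral.integral_interval_sub_left (h0 x hx) (h0 y hy),
    intervalIntegral.integral_interval_sub_left (h0 x hx).norm (h0 y hy).norm]
  exact intervalIntegral.norm_integral_le_abs_integral_norm

lemma ae_hasDerivAt [CompleteSpace E] (h : MemW1p T p u du) (hp : 1 ≤ p) (hT : 0 ≤ T) :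
    ∀ᵐ x, x ∈ Ioo 0 T → HasDerivAt u (du x) x := by
  filter_upwards [(h.intervalIntegrable hp hT).ae_hasDerivAt_integral] with x hx hxT
  have hd := (hx (by rw [uIcc_of_le hT]; exact Ioo_subset_Icc_self hxT) 0 left_mem_uIcc).const_add
    (u 0)
  refine hd.congr_of_eventuallyEq ?_
  filter_upwards [Ioo_mem_nhds hxT.1 hxT.2] with y hy using h.2.2 y (Ioo_subset_Icc_self hy)

end MemW1p

lemma integral_Ioo_norm_le_sqrt_mul {E : Type*} [NormedAddCommGroup E] {T : ℝ} (hT : 0 < T)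
    {f : ℝ → E} (hf : MemLp f 2 (volume.restrict (Ioo 0 T))) :
    ∫ s in Ioo 0 T, ‖f s‖ ≤ √T * √(∫ s in Ioo 0 T, ‖f s‖ ^ 2) := by
  have h1 : IntegrableOn (fun s ↦ ‖f s‖) (Ioo 0 T) := (hf.integrable (by norm_num)).norm
  have h2 : IntegrableOn (fun s ↦ ‖f s‖ ^ 2) (Ioo 0 T) := hf.integrable_norm_pow two_ne_zero
  set J := ∫ s in Ioo 0 T, ‖f s‖
  have h : ∫ s in Ioo 0 T, (2 * (J / T) * ‖f s‖ - (J / T) ^ 2) ≤ ∫ s in Ioo 0 T, ‖f s‖ ^ 2 :=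
    integral_mono ((h1.const_mul _).sub (integrable_const _)) h2 fun s ↦ by
      dsimp only
      nlinarith [sq_nonneg (‖f s‖ - J / T)]
  rw [integral_sub (h1.const_mul _) (integrable_const _), integral_const_mul] at h
  simp only [integral_const, measureReal_restrict_apply_univ, Real.volume_real_Ioo_of_le hT.le,
    sub_zero, smul_eq_mul] at h
  rw [← Real.sqrt_mul hT.le]
  refine Real.le_sqrt_of_sq_le ?_
  have : J ^ 2 = T * (2 * (J / T) * J - T * (J / T) ^ 2) := by
    field_simp
    ring
  rw [this]
  gcongr

/-- The continuous bilinear map bundling an admissible form. -/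
def AdmissibleForm.toCLM {X : Type*} [NormedAddCommGroup X] [InnerProductSpace ℝ X]
    {m M : ℝ} {a : X → X → ℝ} (h : AdmissibleForm m M a) : X →L[ℝ] X →L[ℝ] ℝ :=
  (LinearMap.mk₂ ℝ a h.2.1 h.2.2.1
    (fun v w z ↦ by rw [h.1, h.2.1, h.1 w, h.1 z])
    (fun c v w ↦ by rw [h.1, h.2.2.1, h.1 w, smul_eq_mul])).mkContinuous₂ M h.2.2.2.2

/-- A function satisfying `b(w, ẇ) ≤ ⟨F, ẇ⟩` increases its energy `b(w, w) / 2 - ⟨F, w⟩` by at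
most `sup ‖w‖ * ∫ ‖Ḟ‖`. -/
lemma AdmissibleForm.energy_sub_le {X : Type*} [NormedAddCommGroup X] [InnerProductSpace ℝ X] [CompleteSpace X]
    {m M T : ℝ} (hT : 0 < T) {b : X → X → ℝ} (hb : AdmissibleForm m M b) {w dw : ℝ → X}
    (hw : MemW1p T 2 w dw) {F dF : ℝ → (X →L[ℝ] ℝ)} (hF : MemW1p T 2 F dF)
    (h : ∀ᵐ s ∂(volume.restrict (Ioo (0 : ℝ) T)), b (w s) (dw s) ≤ (F s) (dw s))
    {S : ℝ} (hS : ∀ s ∈ Icc 0 T, ‖w s‖ ≤ S) {t : ℝ} (ht : t ∈ Icc 0 T) :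
    (1 / 2 * b (w t) (w t) - F t (w t)) - (1 / 2 * b (w 0) (w 0) - F 0 (w 0)) ≤
      S * ∫ s in Ioo 0 T, ‖dF s‖ := by
  have hS0 : 0 ≤ S := (norm_nonneg _).trans (hS t ht)
  have hwac := hw.absolutelyContinuousOnInterval (by norm_num) hT.le
  have hFac := hF.absolutelyContinuousOnInterval (by norm_num) hT.le
  have hq : AbsolutelyContinuousOnInterval
      (fun s ↦ 1 / 2 * b (w s) (w s) - F s (w s)) 0 t :=
    (((hwac.bilinear hb.toCLM hwac).const_mul (1 / 2)).fun_sub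
      (hFac.bilinear (ContinuousLinearMap.id ℝ (X →L[ℝ] ℝ)) hwac)).mono
      (uIcc_subset_uIcc left_mem_uIcc (by rwa [uIcc_of_le hT.le]))
  have hdF : IntegrableOn (fun s ↦ S * ‖dF s‖) (Ioo 0 T) :=
    (hF.integrableOn (by norm_num)).norm.const_mul S
  have hsub : Ioo 0 t ⊆ Ioo 0 T := Ioo_subset_Ioo_right ht.2
  rw [← hq.integral_deriv_eq_sub, ← integral_const_mul, intervalIntegral.integral_of_le ht.1,
    integral_Ioc_eq_integral_Ioo]
  refine le_trans (setIntegral_mono_ae_restrict ?_ (hdF.mono_set hsub) ?_)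
    (setIntegral_mono_set hdF (.of_forall fun s ↦ by positivity) hsub.eventuallyLE)
  · exact (intervalIntegrable_iff_integrableOn_Ioo_of_le ht.1).1 hq.intervalIntegrable_deriv
  · rw [EventuallyLE, ae_restrict_iff' measurableSet_Ioo]
    rw [ae_restrict_iff' measurableSet_Ioo] at h
    filter_upwards [h, hw.ae_hasDerivAt (by norm_num) hT.le, hF.ae_hasDerivAt (by norm_num) hT.le]
      with s h1 h2 h3 hs
    replace hs := hsub hs
    specialize h1 hs
    specialize h2 hs
    specialize h3 hs
    have hd : HasDerivAt (fun s ↦ 1 / 2 * b (w s) (w s) - F s (w s))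
        (1 / 2 * (b (w s) (dw s) + b (dw s) (w s)) - (F s (dw s) + dF s (w s))) s :=
      ((hb.toCLM.hasDerivAt_of_bilinear (fun _ ↦ h2) (fun _ ↦ h2)).const_mul (1 / 2)).sub
        ((ContinuousLinearMap.id ℝ (X →L[ℝ] ℝ)).hasDerivAt_of_bilinear
          (fun _ ↦ h3) (fun _ ↦ h2))
    rw [hd.deriv, hb.1 (dw s)]
    have h4 : -(dF s (w s)) ≤ ‖dF s‖ * ‖w s‖ :=
      (neg_le_abs _).trans ((dF s).le_opNorm (w s))
    have h5 : ‖dF s‖ * ‖w s‖ ≤ ‖dF s‖ * S := by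
      gcongr
      exact hS s (Ioo_subset_Icc_self hs)
    linarith

/-- Grönwall-type a priori bound: if `b(w(s), ẇ(s)) ≤ ⟨F(s), ẇ(s)⟩` a.e., then
`sup_{[0,T]} ‖w(t)‖` is controlled by `‖w(0)‖`, `sup_{[0,T]} ‖F(t)‖` and
`(∫₀ᵀ ‖Ḟ(s)‖² ds)^{1/2}`, with a constant depending only on `m`, `M`, `T`. -/
theorem gronwall_type_bound (m M T : ℝ) (hm : 0 < m) (hmM : m ≤ M) (hT : 0 < T) :
    ∃ C : ℝ, 0 < C ∧
      ∀ (X : Type u) [NormedAddCommGroup X] [InnerProductSpace ℝ X] [CompleteSpace X],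
      ∀ (b : X → X → ℝ), AdmissibleForm m M b →
      ∀ (w dw : ℝ → X), MemW1p T 2 w dw →
      ∀ (F dF : ℝ → (X →L[ℝ] ℝ)), MemW1p T 2 F dF →
      (∀ᵐ s ∂(volume.restrict (Ioo (0 : ℝ) T)), b (w s) (dw s) ≤ (F s) (dw s)) →
      ∀ t ∈ Icc (0 : ℝ) T,
        ‖w t‖ ≤ C * (‖w 0‖ + (⨆ t' : Icc (0 : ℝ) T, ‖F t'.1‖) +
          Real.sqrt (∫ s in Ioo (0 : ℝ) T, ‖dF s‖ ^ 2)) := by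
  have hM : 0 < M := hm.trans_le hmM
  refine ⟨2 / m * (2 + M + √T), by positivity, ?_⟩
  intro X _ _ _ b hb w dw hw F dF hF h t ht
  have hwc : ContinuousOn w (Icc 0 T) := by
    simpa only [uIcc_of_le hT.le] using
      (hw.absolutelyContinuousOnInterval (by norm_num) hT.le).continuousOn
  have hFc : ContinuousOn F (Icc 0 T) := by
    simpa only [uIcc_of_le hT.le] using
      (hF.absolutelyContinuousOnInterval (by norm_num) hT.le).continuousOn
  have h0 : (0 : ℝ) ∈ Icc 0 T := left_mem_Icc.2 hT.le
  obtain ⟨τ, hτ, hmax⟩ := isCompact_Icc.exists_isMaxOn ⟨0, h0⟩ hwc.norm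
  have hmax' : ∀ s ∈ Icc 0 T, ‖w s‖ ≤ ‖w τ‖ := hmax
  have hbdd : BddAbove (range fun t' : Icc (0 : ℝ) T ↦ ‖F t'.1‖) := by
    rw [← image_eq_range (fun s ↦ ‖F s‖)]
    exact isCompact_Icc.bddAbove_image hFc.norm
  have hA : ∀ s ∈ Icc 0 T, ‖F s‖ ≤ ⨆ t' : Icc (0 : ℝ) T, ‖F t'.1‖ := fun s hs ↦
    le_ciSup hbdd ⟨s, hs⟩
  have hE := AdmissibleForm.energy_sub_le hT hb hw hF h hmax' hτ
  have hD := integral_Ioo_norm_le_sqrt_mul hT hF.memLp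
  set A := ⨆ t' : Icc (0 : ℝ) T, ‖F t'.1‖
  set D := √(∫ s in Ioo 0 T, ‖dF s‖ ^ 2)
  have hA0 : 0 ≤ A := (norm_nonneg _).trans (hA 0 h0)
  have hD0 : 0 ≤ D := Real.sqrt_nonneg _
  refine (hmax' t ht).trans ?_
  have hS0 := hmax' 0 h0
  set S := ‖w τ‖
  rcases (norm_nonneg (w τ)).eq_or_lt with hz | hpos
  · rw [show S = 0 from hz.symm]
    positivity
  have hcoer : m * S ^ 2 ≤ b (w τ) (w τ) := hb.2.2.2.1 _
  have hb0 : b (w 0) (w 0) ≤ M * ‖w 0‖ * S :=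
    ((le_abs_self _).trans (hb.2.2.2.2 _ _)).trans (by gcongr)
  have hFτ : F τ (w τ) ≤ A * S :=
    (le_abs_self _).trans (((F τ).le_opNorm (w τ)).trans (by gcongr; exact hA τ hτ))
  have hF0 : -(F 0 (w 0)) ≤ A * S :=
    (neg_le_abs _).trans (((F 0).le_opNorm (w 0)).trans (by gcongr; exact hA 0 h0))
  have hint : S * ∫ s in Ioo 0 T, ‖dF s‖ ≤ S * (√T * D) := by gcongr
  have hlin : m / 2 * S ≤ 2 * A + M / 2 * ‖w 0‖ + √T * D := by
    refine le_of_mul_le_mul_right ?_ hpos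
    linarith
  have hR : 2 * A + M / 2 * ‖w 0‖ + √T * D ≤ (2 + M + √T) * (‖w 0‖ + A + D) := by
    have hsq := Real.sqrt_nonneg T
    have hw0 := norm_nonneg (w 0)
    have : 0 ≤ 2 * ‖w 0‖ + 2 * D + M / 2 * ‖w 0‖ + M * A + M * D + √T * ‖w 0‖ + √T * A := by
      positivity
    linarith
  calc S = 2 / m * (m / 2 * S) := by field_simp
    _ ≤ 2 / m * ((2 + M + √T) * (‖w 0‖ + A + D)) :=
      mul_le_mul_of_nonneg_left (hlin.trans hR) (by positivity)
    _ = 2 / m * (2 + M + √T) * (‖w 0‖ + A + D) := by ring
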